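/- Let V be a singular Minkowski space, let v ∈ V with ‖v‖ = 1 be a direction at which the norm ‖·‖ is Fréchet differentiable (a regular direction), and let (x_k) be a sequence with ‖x_k‖ → ∞ and x_k/‖x_k‖ → v. Then for every y ∈ V both limits below exist and are equal: lim_{k→∞}(‖y − x_k‖ − ‖x_k‖) = lim_{t→∞}(‖y − t·v‖ − t). In other words, the limiting horofunction of the sequence (x_k) is the Busemann function of the ray t ↦ t·v. -/

import Mathlib

open Filter

/-- By convexity, a unit step `y` from `x` increases the norm at most at the average rate over the
longer step `(‖x‖ * s) • y`, here rescaled to start at the unit vector `(‖x‖)⁻¹ • x`. -/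
theorem norm_add_sub_norm_le_slope {V : Type*} [NormedAddCommGroup V] [NormedSpace ℝ V]
    {x y : V} {s : ℝ} (hs : 0 < s) (hx : 1 ≤ ‖x‖ * s) :
    ‖x + y‖ - ‖x‖ ≤ s⁻¹ * (‖(‖x‖)⁻¹ • x + s • y‖ - 1) := by
  have hr : 0 < ‖x‖ := pos_of_mul_pos_left (one_pos.trans_le hx) hs.le
  have hb : 0 ≤ 1 - (‖x‖ * s)⁻¹ := sub_nonneg.2 (inv_le_one_of_one_le₀ hx)
  have hdecomp : x + y = (1 - (‖x‖ * s)⁻¹) • x + s⁻¹ • ((‖x‖)⁻¹ • x + s • y) := by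
    match_scalars <;> field_simp
    ring
  have hle : ‖x + y‖ ≤ (1 - (‖x‖ * s)⁻¹) * ‖x‖ + s⁻¹ * ‖(‖x‖)⁻¹ • x + s • y‖ := by
    calc ‖x + y‖ = ‖(1 - (‖x‖ * s)⁻¹) • x + s⁻¹ • ((‖x‖)⁻¹ • x + s • y)‖ := by rw [← hdecomp]
      _ ≤ _ := norm_add_le _ _
      _ = _ := by
        rw [norm_smul, norm_smul, Real.norm_of_nonneg hb, Real.norm_of_nonneg (inv_pos.2 hs).le]
  have hcancel : (1 - (‖x‖ * s)⁻¹) * ‖x‖ = ‖x‖ - s⁻¹ := by field_simp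
  rw [hcancel] at hle
  linarith

/-- If `x` tends to infinity in a direction `v` at which the norm is differentiable, then
`‖x + y‖ - ‖x‖` is eventually below every number above the derivative of the norm along `y`. -/
theorem eventually_norm_add_sub_norm_lt {V ι : Type*} [NormedAddCommGroup V] [NormedSpace ℝ V]
    {l : Filter ι} {v : V} (hv : ‖v‖ = 1) {D : V →L[ℝ] ℝ}
    (hD : HasFDerivAt (fun w : V => ‖w‖) D v) {x : ι → V}
    (hx : Tendsto (fun k => ‖x k‖) l atTop)
    (hdir : Tendsto (fun k => (‖x k‖)⁻¹ • x k) l (nhds v)) (y : V) {c : ℝ} (hc : D y < c) :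
    ∀ᶠ k in l, ‖x k + y‖ - ‖x k‖ < c := by
  have hslope := (hD.hasLineDerivAt y).tendsto_slope_zero_right
  obtain ⟨s, hsc, hs⟩ := ((hslope.eventually_lt_const hc).and self_mem_nhdsWithin).exists
  replace hs : 0 < s := hs
  rw [hv, smul_eq_mul] at hsc
  have hlim : Tendsto (fun k => s⁻¹ * (‖(‖x k‖)⁻¹ • x k + s • y‖ - 1)) l
      (nhds (s⁻¹ * (‖v + s • y‖ - 1))) :=
    (((hdir.add_const (s • y)).norm).sub_const 1).const_mul _
  filter_upwards [hlim.eventually_lt_const hsc, hx.eventually_ge_atTop s⁻¹] with k hk hk'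
  refine (norm_add_sub_norm_le_slope hs ?_).trans_lt hk
  exact (inv_le_iff_one_le_mul₀ hs).1 hk'

/-- If `x` tends to infinity in a direction `v` at which the norm has derivative `D`, then the
normalized distance functions of `x` converge pointwise to `-D`. -/
theorem tendsto_norm_sub_sub_norm {V ι : Type*} [NormedAddCommGroup V] [NormedSpace ℝ V]
    {l : Filter ι} {v : V} (hv : ‖v‖ = 1) {D : V →L[ℝ] ℝ}
    (hD : HasFDerivAt (fun w : V => ‖w‖) D v) {x : ι → V}
    (hx : Tendsto (fun k => ‖x k‖) l atTop)
    (hdir : Tendsto (fun k => (‖x k‖)⁻¹ • x k) l (nhds v)) (y : V) :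
    Tendsto (fun k => ‖y - x k‖ - ‖x k‖) l (nhds (-D y)) := by
  refine tendsto_order.2 ⟨fun c hc => ?_, fun c hc => ?_⟩
  · filter_upwards [eventually_norm_add_sub_norm_lt hv hD hx hdir y (lt_neg_of_lt_neg hc)]
      with k hk
    have htri : ‖(2 : ℝ) • x k‖ ≤ ‖x k + y‖ + ‖y - x k‖ := by
      rw [show (2 : ℝ) • x k = (x k + y) - (y - x k) by module]
      exact norm_sub_le _ _
    rw [norm_smul, Real.norm_two] at htri
    linarith
  · filter_upwards [eventually_norm_add_sub_norm_lt hv hD hx hdir (-y) (by simpa using hc)]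
      with k hk
    rwa [norm_sub_rev, sub_eq_add_neg (x k)]

/-- In a singular Minkowski space, if `v` is a regular direction (the norm is Fréchet
differentiable at `v`), `‖x_k‖ → ∞` and `x_k/‖x_k‖ → v`, then the normalized distance
functions of `x_k` converge pointwise to the Busemann function of the ray `t ↦ t • v`. -/
theorem horofunction_eq_busemann_of_regular_direction {V : Type*} [NormedAddCommGroup V]
    [NormedSpace ℝ V] [FiniteDimensional ℝ V]
    (hsc : ∀ x y : V, ‖x‖ = 1 → ‖y‖ = 1 → x ≠ y → ‖(2 : ℝ)⁻¹ • (x + y)‖ < 1)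
    (v : V) (hv : ‖v‖ = 1)
    (hreg : DifferentiableAt ℝ (fun w : V => ‖w‖) v)
    (x : ℕ → V)
    (hx : Tendsto (fun k => ‖x k‖) atTop atTop)
    (hdir : Tendsto (fun k => (‖x k‖)⁻¹ • x k) atTop (nhds v)) :
    ∀ y : V, ∃ L : ℝ,
      Tendsto (fun k => ‖y - x k‖ - ‖x k‖) atTop (nhds L) ∧
      Tendsto (fun t : ℝ => ‖y - t • v‖ - t) atTop (nhds L) := by
  intro y
  refine ⟨_, tendsto_norm_sub_sub_norm hv hreg.hasFDerivAt hx hdir y, ?_⟩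
  have hnorm : ∀ t : ℝ, 0 < t → ‖t • v‖ = t := fun t ht => by
    rw [norm_smul, hv, mul_one, Real.norm_of_nonneg ht.le]
  have hray : Tendsto (fun t : ℝ => ‖t • v‖) atTop atTop :=
    tendsto_id.congr' <| (eventually_gt_atTop 0).mono fun t ht => (hnorm t ht).symm
  have hraydir : Tendsto (fun t : ℝ => (‖t • v‖)⁻¹ • t • v) atTop (nhds v) :=
    tendsto_const_nhds.congr' <| (eventually_gt_atTop 0).mono fun t ht => by
      simp only [hnorm t ht, inv_smul_smul₀ ht.ne']
  refine (tendsto_norm_sub_sub_norm hv hreg.hasFDerivAt hray hraydir y).congr' ?_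
  filter_upwards [eventually_gt_atTop 0] with t ht
  rw [hnorm t ht]
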